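/- arXiv:2511.09181 — 10 statements merged into one kernel-verified Lean document; each statement's English description precedes it below -/
import Mathlib

section
/- Let K be a number field with ring of integers 𝓞_K, let δ > 0 and let σ, τ be real numbers with σ ≥ 1 + δ. Then the family indexed by triples (n, 𝔭, k) — where n, k range over the positive integers and 𝔭 over the nonzero prime ideals of 𝓞_K — with terms |μ(n)| · n^{-(τ+1)} · k^{-1} · N(𝔭)^{-k·n·σ} is summable, where μ is the Möbius function and N(𝔭) is the absolute norm (cardinality of the residue field) of 𝔭. -/
open NumberField

open Filter Asymptotics in
/-- The number of nonzero ideals of `𝓞 K` of norm at most `n` is `O(n)`. -/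
lemma sum_card_absNorm_eq_isBigO (K : Type*) [Field K] [NumberField K] :
    (fun n : ℕ ↦ ∑ k ∈ Finset.Icc 1 n,
      (Nat.card {I : Ideal (𝓞 K) // Ideal.absNorm I = k} : ℝ)) =O[atTop]
      fun n ↦ (n : ℝ) ^ (1 : ℝ) := by
  have h := ((Ideal.tendsto_norm_le_div_atTop K).comp tendsto_natCast_atTop_atTop).isBigO_one ℝ
  have h' := h.mul (isBigO_refl (fun n : ℕ ↦ (n : ℝ) ^ (1 : ℝ)) atTop)
  simp only [one_mul] at h'
  refine IsBigO.trans (IsBigO.of_bound 1 ?_) h'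
  filter_upwards [eventually_gt_atTop 0] with n hn
  have hn' : (n : ℝ) ≠ 0 := by positivity
  simp only [Function.comp_apply, Nat.cast_le, Real.rpow_one, div_mul_cancel₀ _ hn', one_mul]
  rw [Real.norm_of_nonneg (by positivity), Real.norm_of_nonneg (by positivity), ← Nat.cast_sum,
    Nat.cast_le, Nat.card_congr (Equiv.subtypeEquivRight (q := (· ∈
      (Ideal.absNorm : Ideal (𝓞 K) → ℕ) ⁻¹' (Finset.Icc 0 n : Set ℕ))) fun _ ↦ by simp)]
  refine (Finset.sum_le_sum_of_subset (Finset.Icc_subset_Icc_left zero_le_one)).trans_eq ?_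
  exact (Finset.card_preimage_eq_sum_card_image_eq
    (fun k _ ↦ Ideal.finite_setOfPred_absNorm_eq k)).symm

/-- The Dedekind zeta series `∑ N(I) ^ (-σ)` over the ideals of `𝓞 K` converges for `σ > 1`. -/
lemma summable_absNorm_rpow_neg (K : Type*) [Field K] [NumberField K] {σ : ℝ} (hσ : 1 < σ) :
    Summable fun I : Ideal (𝓞 K) ↦ (Ideal.absNorm I : ℝ) ^ (-σ) := by
  have hL := (LSeriesSummable_of_sum_norm_bigO_and_nonneg (s := (σ : ℂ))
    (sum_card_absNorm_eq_isBigO K) (fun _ ↦ Nat.cast_nonneg _) zero_le_one (by simpa)).norm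
  rw [← (Equiv.sigmaFiberEquiv (Ideal.absNorm : Ideal (𝓞 K) → ℕ)).summable_iff,
    summable_sigma_of_nonneg fun _ ↦ by simp only [Function.comp_apply]; positivity]
  have key (n : ℕ) (y : {I : Ideal (𝓞 K) // Ideal.absNorm I = n}) :
      ((fun I : Ideal (𝓞 K) ↦ (Ideal.absNorm I : ℝ) ^ (-σ)) ∘
        Equiv.sigmaFiberEquiv (Ideal.absNorm : Ideal (𝓞 K) → ℕ)) ⟨n, y⟩ = (n : ℝ) ^ (-σ) := by
    simp [Equiv.sigmaFiberEquiv, y.2]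
  refine ⟨fun n ↦ ?_, hL.congr fun n ↦ ?_⟩
  · have : Finite {I : Ideal (𝓞 K) // Ideal.absNorm I = n} := Ideal.finite_setOfPred_absNorm_eq n
    exact Summable.of_finite
  · simp only [key, tsum_const, nsmul_eq_mul]
    rcases eq_or_ne n 0 with rfl | hn
    · simp [Real.zero_rpow (by linarith : -σ ≠ 0)]
    · rw [LSeries.norm_term_eq, if_neg hn, Complex.ofReal_re, Real.rpow_neg (Nat.cast_nonneg _),
        div_eq_mul_inv]
      simp

/-- For `N ≥ 2` and `σ ≥ 1`, the inequality `k n ≥ k + n - 1` separates the variables in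
`N ^ (-k n σ)`. -/
lemma rpow_neg_mul_mul_le {N k n σ : ℝ} (hN : 2 ≤ N) (hk : 1 ≤ k) (hn : 1 ≤ n) (hσ : 1 ≤ σ) :
    N ^ (-(k * n * σ)) ≤ (2 : ℝ) ^ (1 - n) * (N ^ (-σ) * (2 : ℝ) ^ (1 - k)) := by
  have hN0 : 0 < N := by linarith
  have h2 {m : ℝ} (hm : 1 ≤ m) : N ^ (1 - m) ≤ (2 : ℝ) ^ (1 - m) :=
    Real.rpow_le_rpow_of_nonpos two_pos hN (by linarith)
  calc N ^ (-(k * n * σ)) ≤ N ^ ((1 - n) + (-σ + (1 - k))) := by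
        refine Real.rpow_le_rpow_of_exponent_le (by linarith) ?_
        nlinarith [mul_nonneg (mul_nonneg (sub_nonneg.2 hk) (sub_nonneg.2 hn))
          (zero_le_one.trans hσ), mul_nonneg (sub_nonneg.2 hk) (sub_nonneg.2 hσ),
          mul_nonneg (sub_nonneg.2 hn) (sub_nonneg.2 hσ)]
    _ = N ^ (1 - n) * (N ^ (-σ) * N ^ (1 - k)) := by rw [Real.rpow_add hN0, Real.rpow_add hN0]
    _ ≤ _ :=
        mul_le_mul (h2 hn) (mul_le_mul_of_nonneg_left (h2 hk) (by positivity))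
          (by positivity) (by positivity)

/-- A real power times a decaying geometric sequence is summable. -/
lemma summable_rpow_mul_two_rpow (a : ℝ) :
    Summable fun n : ℕ ↦ (n : ℝ) ^ a * (2 : ℝ) ^ (1 - (n : ℝ)) := by
  obtain ⟨m, hm⟩ := exists_nat_ge a
  have h := (summable_pow_mul_geometric_of_norm_lt_one m
    (r := (1 / 2 : ℝ)) (by norm_num)).mul_left 2
  rw [← summable_nat_add_iff 1] at h ⊢
  refine h.of_nonneg_of_le (fun n ↦ by positivity) fun n ↦ ?_
  have h1 : ((n + 1 : ℕ) : ℝ) ^ a ≤ ((n + 1 : ℕ) : ℝ) ^ m := by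
    rw [← Real.rpow_natCast]
    exact Real.rpow_le_rpow_of_exponent_le (by simp) hm
  have h2 : (2 : ℝ) ^ (1 - ((n + 1 : ℕ) : ℝ)) = 2 * (1 / 2) ^ (n + 1) := by
    rw [Real.rpow_sub two_pos, Real.rpow_one, Real.rpow_natCast, one_div, inv_pow, div_eq_mul_inv]
  rw [h2, mul_left_comm]
  gcongr

/-- Let `K` be a number field with ring of integers `𝓞 K`, let `δ > 0` and
`σ ≥ 1 + δ`, `τ : ℝ`. Then the family indexed by triples `(n, 𝔭, k)` — `n, k` positive
integers, `𝔭` a nonzero prime ideal of `𝓞 K` — with terms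
`|μ(n)| · n^{-(τ+1)} · k⁻¹ · N(𝔭)^{-k·n·σ}` is summable. -/
theorem stmt0 (K : Type*) [Field K] [NumberField K] (δ σ τ : ℝ) (hδ : 0 < δ)
    (hσ : 1 + δ ≤ σ) :
    Summable (fun x : ℕ+ × {p : Ideal (𝓞 K) // p.IsPrime ∧ p ≠ ⊥} × ℕ+ =>
      |((ArithmeticFunction.moebius x.1 : ℤ) : ℝ)| * ((x.1 : ℕ) : ℝ) ^ (-(τ + 1)) *
        (((x.2.2 : ℕ) : ℝ))⁻¹ *
        ((Ideal.absNorm x.2.1.1 : ℕ) : ℝ) ^ (-(((x.2.2 : ℕ) : ℝ) * ((x.1 : ℕ) : ℝ) * σ))) := by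
  have hσ1 : 1 < σ := by linarith
  have hn : Summable fun n : ℕ+ ↦ ((n : ℕ) : ℝ) ^ (-(τ + 1)) * (2 : ℝ) ^ (1 - ((n : ℕ) : ℝ)) :=
    (summable_rpow_mul_two_rpow (-(τ + 1))).comp_injective PNat.coe_injective
  have hk : Summable fun k : ℕ+ ↦ (2 : ℝ) ^ (1 - ((k : ℕ) : ℝ)) := by
    simpa [Function.comp_def] using
      (summable_rpow_mul_two_rpow 0).comp_injective PNat.coe_injective
  have hp : Summable fun p : {p : Ideal (𝓞 K) // p.IsPrime ∧ p ≠ ⊥} ↦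
      (Ideal.absNorm p.1 : ℝ) ^ (-σ) :=
    (summable_absNorm_rpow_neg K hσ1).comp_injective Subtype.val_injective
  have hpk := hp.mul_of_nonneg hk (fun _ ↦ by positivity) (fun _ ↦ by positivity)
  refine (hn.mul_of_nonneg hpk (fun _ ↦ by positivity) (fun _ ↦ by positivity)).of_nonneg_of_le
    (fun _ ↦ by positivity) ?_
  rintro ⟨n, ⟨p, hprime, hbot⟩, k⟩
  have hn1 : (1 : ℝ) ≤ ((n : ℕ) : ℝ) := by exact_mod_cast n.pos
  have hk1 : (1 : ℝ) ≤ ((k : ℕ) : ℝ) := by exact_mod_cast k.pos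
  have hN : (2 : ℝ) ≤ (Ideal.absNorm p : ℝ) := by
    have h0 : Ideal.absNorm p ≠ 0 := Ideal.absNorm_eq_zero_iff.not.2 hbot
    have h1 : Ideal.absNorm p ≠ 1 := Ideal.absNorm_eq_one_iff.not.2 hprime.ne_top
    exact_mod_cast (by omega : 2 ≤ Ideal.absNorm p)
  have hμ : |((ArithmeticFunction.moebius n : ℤ) : ℝ)| ≤ 1 := by
    exact_mod_cast ArithmeticFunction.abs_moebius_le_one (n := (n : ℕ))
  calc |((ArithmeticFunction.moebius n : ℤ) : ℝ)| * ((n : ℕ) : ℝ) ^ (-(τ + 1)) *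
        ((k : ℕ) : ℝ)⁻¹ * (Ideal.absNorm p : ℝ) ^ (-(((k : ℕ) : ℝ) * ((n : ℕ) : ℝ) * σ))
      ≤ 1 * ((n : ℕ) : ℝ) ^ (-(τ + 1)) * 1 * ((2 : ℝ) ^ (1 - ((n : ℕ) : ℝ)) *
        ((Ideal.absNorm p : ℝ) ^ (-σ) * (2 : ℝ) ^ (1 - ((k : ℕ) : ℝ)))) := by
        gcongr
        · exact inv_le_one_of_one_le₀ hk1
        · exact rpow_neg_mul_mul_le hN hk1 hn1 hσ1.le
    _ = _ := by ring
end

section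
/- Let m ≥ 1 and let χ be a Dirichlet character modulo m. For every complex s with Re(s) > 1, ∑_{p prime} χ(p) p^{-s} = ∑_{n=1}^{∞} (μ(n)/n) ∑_{p prime} ∑_{k=1}^{∞} χ(p)^{nk} / (k · p^{nks}), where μ is the Möbius function; all series converge absolutely. -/
/-- For `r < 1`, the family `r ^ (n - 1)` over the positive integers is summable. -/
theorem summable_pnat_geometric_natPred {r : ℝ} (h0 : 0 ≤ r) (h1 : r < 1) :
    Summable (fun n : ℕ+ => r ^ n.natPred) :=
  (Equiv.pnatEquivNat.summable_iff (f := fun n : ℕ => r ^ n)).2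
    (summable_geometric_of_lt_one h0 h1)

theorem pow_mul_le_of_le_one {a r : ℝ} (h0 : 0 ≤ a) (har : a ≤ r) (h1 : r ≤ 1) (n k : ℕ+) :
    a ^ ((n : ℕ) * (k : ℕ)) ≤ r ^ n.natPred * (a * r ^ k.natPred) := by
  have hn := n.natPred_add_one
  have hk := k.natPred_add_one
  rw [← hn, ← hk]
  generalize n.natPred = x
  generalize k.natPred = y
  calc a ^ ((x + 1) * (y + 1)) ≤ a ^ (x + (1 + y)) :=
        pow_le_pow_of_le_one h0 (har.trans h1) (by nlinarith)
    _ = a ^ x * (a * a ^ y) := by ring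
    _ ≤ _ := by
        have := h0.trans har
        gcongr

/-- The Lambert-type family `c n * z i ^ (n k) / k`, with `c` bounded by `1`, is summable. -/
theorem summable_mul_pow_mul_div {ι : Type*} {z : ι → ℂ} {r : ℝ} (h1 : r < 1)
    (hz : Summable (fun i => ‖z i‖)) (hr0 : 0 ≤ r) (hr : ∀ i, ‖z i‖ ≤ r) {c : ℕ+ → ℂ}
    (hc : ∀ n, ‖c n‖ ≤ 1) :
    Summable (fun x : ℕ+ × (ι × ℕ+) =>
      c x.1 * (z x.2.1 ^ ((x.1 : ℕ) * (x.2.2 : ℕ)) / ((x.2.2 : ℕ) : ℂ))) := by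
  have hg := summable_pnat_geometric_natPred hr0 h1
  have hb := hg.mul_of_nonneg
    (hz.mul_of_nonneg hg (fun _ => norm_nonneg _) (fun _ => pow_nonneg hr0 _))
    (fun _ => pow_nonneg hr0 _) (fun _ => mul_nonneg (norm_nonneg _) (pow_nonneg hr0 _))
  refine hb.of_norm_bounded fun ⟨n, i, k⟩ => ?_
  refine le_trans ?_ (pow_mul_le_of_le_one (norm_nonneg (z i)) (hr i) h1.le n k)
  rw [norm_mul, norm_div, norm_pow, Complex.norm_natCast]
  have hk : (1 : ℝ) ≤ ((k : ℕ) : ℝ) := by exact_mod_cast k.pos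
  refine (mul_le_of_le_one_left (by positivity) (hc n)).trans ?_
  exact div_le_self (by positivity) hk

theorem norm_moebius_div_le_one (n : ℕ+) :
    ‖((ArithmeticFunction.moebius n : ℤ) : ℂ) / ((n : ℕ) : ℂ)‖ ≤ 1 := by
  have hn : (1 : ℝ) ≤ ((n : ℕ) : ℝ) := by exact_mod_cast n.pos
  rw [norm_div, Complex.norm_natCast, Complex.norm_intCast]
  refine div_le_one_of_le₀ (le_trans ?_ hn) (by positivity)
  exact_mod_cast ArithmeticFunction.abs_moebius_le_one (n := (n : ℕ))

theorem sum_divisorsAntidiagonal_moebius_div_mul_pow_div (z : ℂ) (N : ℕ+) :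
    ∑ x ∈ (N : ℕ).divisorsAntidiagonal,
      ((ArithmeticFunction.moebius x.1 : ℤ) : ℂ) / (x.1 : ℂ) * (z ^ (x.1 * x.2) / (x.2 : ℂ)) =
        if N = 1 then z else 0 := by
  have hμ : ∑ x ∈ (N : ℕ).divisorsAntidiagonal, ((ArithmeticFunction.moebius x.1 : ℤ) : ℂ) =
      if N = 1 then 1 else 0 := by
    have h := congrArg (fun f : ArithmeticFunction ℤ => f N)
      ArithmeticFunction.moebius_mul_coe_zeta
    simp only [ArithmeticFunction.coe_mul_zeta_apply, ArithmeticFunction.one_apply,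
      PNat.coe_eq_one_iff] at h
    rw [← Int.cast_sum, Nat.sum_divisorsAntidiagonal (f := fun a _ => ArithmeticFunction.moebius a),
      h]
    split_ifs <;> simp
  calc _ = ∑ x ∈ (N : ℕ).divisorsAntidiagonal,
        ((ArithmeticFunction.moebius x.1 : ℤ) : ℂ) * (z ^ (N : ℕ) / ((N : ℕ) : ℂ)) := by
        refine Finset.sum_congr rfl fun x hx => ?_
        rw [← (Nat.mem_divisorsAntidiagonal.1 hx).1, Nat.cast_mul, div_mul_div_comm, mul_div_assoc]
    _ = _ := by
        rw [← Finset.sum_mul, hμ]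
        split_ifs with h <;> simp [h]

/-- `∑ₙ (μ(n)/n) ∑ₖ z ^ (n k) / k = z`, as a sum over pairs `(n, k)`. -/
theorem tsum_moebius_div_mul_pow_div {z : ℂ} (h1 : ‖z‖ < 1) :
    ∑' x : ℕ+ × ℕ+, ((ArithmeticFunction.moebius x.1 : ℤ) : ℂ) / ((x.1 : ℕ) : ℂ) *
      (z ^ ((x.1 : ℕ) * (x.2 : ℕ)) / ((x.2 : ℕ) : ℂ)) = z := by
  have hs := summable_mul_pow_mul_div (ι := Unit) (z := fun _ => z) h1
    (Summable.of_finite) (norm_nonneg z) (fun _ => le_rfl) norm_moebius_div_le_one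
  have hs' := (((Equiv.refl ℕ+).prodCongr (Equiv.punitProd ℕ+).symm).summable_iff).2 hs
  have hs'' := sigmaAntidiagonalEquivProd.summable_iff.2 hs'
  rw [← sigmaAntidiagonalEquivProd.tsum_eq]
  refine hs''.tsum_sigma.trans ?_
  refine (tsum_congr fun N => ?_).trans (tsum_ite_eq (1 : ℕ+) fun _ => z)
  rw [tsum_fintype, ← sum_divisorsAntidiagonal_moebius_div_mul_pow_div z N]
  exact Finset.sum_coe_sort (N : ℕ).divisorsAntidiagonal fun x =>
    ((ArithmeticFunction.moebius x.1 : ℤ) : ℂ) / (x.1 : ℂ) * (z ^ (x.1 * x.2) / (x.2 : ℂ))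

/-- `∑ᵢ z i = ∑ₙ (μ(n)/n) ∑ᵢ ∑ₖ (z i) ^ (n k) / k`, where the inner sum over `i` and `k` is
`∑ᵢ -log (1 - (z i) ^ n)`. -/
theorem tsum_eq_tsum_moebius_div_mul_tsum {ι : Type*} {z : ι → ℂ} {r : ℝ} (h1 : r < 1)
    (hz : Summable (fun i => ‖z i‖)) (hr0 : 0 ≤ r) (hr : ∀ i, ‖z i‖ ≤ r) :
    ∑' i, z i = ∑' n : ℕ+, ((ArithmeticFunction.moebius n : ℤ) : ℂ) / ((n : ℕ) : ℂ) *
      ∑' x : ι × ℕ+, z x.1 ^ ((n : ℕ) * (x.2 : ℕ)) / ((x.2 : ℕ) : ℂ) := by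
  have hs := summable_mul_pow_mul_div h1 hz hr0 hr norm_moebius_div_le_one
  simp_rw [← tsum_mul_left]
  rw [← hs.tsum_prod]
  let e : ι × (ℕ+ × ℕ+) ≃ ℕ+ × (ι × ℕ+) :=
    { toFun := fun x => (x.2.1, x.1, x.2.2)
      invFun := fun x => (x.2.1, x.1, x.2.2)
      left_inv := fun _ => rfl
      right_inv := fun _ => rfl }
  rw [← e.tsum_eq]
  refine Eq.trans ?_ (e.summable_iff.2 hs).tsum_prod.symm
  exact tsum_congr fun i => (tsum_moebius_div_mul_pow_div ((hr i).trans_lt h1)).symm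


/-- Let `m ≥ 1` and `χ` a Dirichlet character mod `m`. For `Re(s) > 1`,
`∑_p χ(p) p^{-s} = ∑_{n≥1} (μ(n)/n) ∑_p ∑_{k≥1} χ(p)^{nk}/(k p^{nks})`;
all series converge (absolutely, as these are series of complex numbers). -/
theorem stmt2 (m : ℕ) (hm : 1 ≤ m) (χ : DirichletCharacter ℂ m) (s : ℂ) (hs : 1 < s.re) :
    Summable (fun p : {p : ℕ // p.Prime} => χ (p : ZMod m) * ((p : ℕ) : ℂ) ^ (-s)) ∧
    (∀ n : ℕ+, Summable (fun x : {p : ℕ // p.Prime} × ℕ+ =>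
      (χ ((x.1 : ℕ) : ZMod m)) ^ ((n : ℕ) * (x.2 : ℕ)) /
        (((x.2 : ℕ) : ℂ) * ((x.1 : ℕ) : ℂ) ^ ((((n : ℕ) : ℂ) * ((x.2 : ℕ) : ℂ)) * s)))) ∧
    Summable (fun n : ℕ+ =>
      ((ArithmeticFunction.moebius n : ℤ) : ℂ) / ((n : ℕ) : ℂ) *
        ∑' x : {p : ℕ // p.Prime} × ℕ+,
          (χ ((x.1 : ℕ) : ZMod m)) ^ ((n : ℕ) * (x.2 : ℕ)) /
            (((x.2 : ℕ) : ℂ) * ((x.1 : ℕ) : ℂ) ^ ((((n : ℕ) : ℂ) * ((x.2 : ℕ) : ℂ)) * s))) ∧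
    (∑' p : {p : ℕ // p.Prime}, χ (p : ZMod m) * ((p : ℕ) : ℂ) ^ (-s)) =
      ∑' n : ℕ+, ((ArithmeticFunction.moebius n : ℤ) : ℂ) / ((n : ℕ) : ℂ) *
        ∑' x : {p : ℕ // p.Prime} × ℕ+,
          (χ ((x.1 : ℕ) : ZMod m)) ^ ((n : ℕ) * (x.2 : ℕ)) /
            (((x.2 : ℕ) : ℂ) * ((x.1 : ℕ) : ℂ) ^ ((((n : ℕ) : ℂ) * ((x.2 : ℕ) : ℂ)) * s)) := by
  have hp0 : ∀ p : {p : ℕ // p.Prime}, ‖χ ((p : ℕ) : ZMod m) * ((p : ℕ) : ℂ) ^ (-s)‖ ≤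
      ((p : ℕ) : ℝ) ^ (-s.re) := fun p => by
    rw [norm_mul, Complex.norm_natCast_cpow_of_pos p.2.pos, Complex.neg_re]
    exact mul_le_of_le_one_left (by positivity) (χ.norm_le_one _)
  have hr : ∀ p : {p : ℕ // p.Prime}, ‖χ ((p : ℕ) : ZMod m) * ((p : ℕ) : ℂ) ^ (-s)‖ ≤ 1 / 2 := by
    refine fun p => (hp0 p).trans ?_
    have h2 : (2 : ℝ) ≤ ((p : ℕ) : ℝ) := by exact_mod_cast p.2.two_le
    calc ((p : ℕ) : ℝ) ^ (-s.re) ≤ ((p : ℕ) : ℝ) ^ (-1 : ℝ) :=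
          Real.rpow_le_rpow_of_exponent_le (by linarith) (by linarith)
      _ = 1 / ((p : ℕ) : ℝ) := by rw [Real.rpow_neg_one, one_div]
      _ ≤ 1 / 2 := by gcongr
  have hz : Summable (fun p : {p : ℕ // p.Prime} =>
      ‖χ ((p : ℕ) : ZMod m) * ((p : ℕ) : ℂ) ^ (-s)‖) :=
    (Nat.Primes.summable_rpow.2 (by linarith)).of_nonneg_of_le (fun _ => norm_nonneg _) hp0
  have hterm : ∀ (n : ℕ+) (x : {p : ℕ // p.Prime} × ℕ+),
      (χ ((x.1 : ℕ) : ZMod m)) ^ ((n : ℕ) * (x.2 : ℕ)) /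
        (((x.2 : ℕ) : ℂ) * ((x.1 : ℕ) : ℂ) ^ ((((n : ℕ) : ℂ) * ((x.2 : ℕ) : ℂ)) * s)) =
      (χ ((x.1 : ℕ) : ZMod m) * ((x.1 : ℕ) : ℂ) ^ (-s)) ^ ((n : ℕ) * (x.2 : ℕ)) /
        ((x.2 : ℕ) : ℂ) := fun n x => by
    rw [← Nat.cast_mul, Complex.cpow_nat_mul, mul_pow, Complex.cpow_neg, inv_pow, div_mul_eq_div_div,
      ← div_eq_mul_inv, div_right_comm]
  have h12 : (1 / 2 : ℝ) < 1 := by norm_num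
  have h02 : (0 : ℝ) ≤ 1 / 2 := by norm_num
  simp only [hterm]
  refine ⟨hz.of_norm, fun n => ?_, ?_, tsum_eq_tsum_moebius_div_mul_tsum h12 hz h02 hr⟩
  · simpa using (summable_mul_pow_mul_div (c := 1) h12 hz h02 hr (by simp)).prod_factor n
  · simp_rw [← tsum_mul_left]
    exact (summable_mul_pow_mul_div h12 hz h02 hr norm_moebius_div_le_one).prod
end

section
/- Let m ≥ 2 and let χ₀ be the principal Dirichlet character modulo m. Let ℓ = ω(m) be the number of distinct prime divisors of m. Then, as s → 0 with s ≠ 0, the quotient L(s, χ₀) / s^{ℓ} tends to -(1/2) · ∏_{p | m, p prime} log p, and this limit is nonzero; in particular the L-function of the principal character modulo m vanishes to order exactly ω(m) at s = 0. -/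
open Filter Topology

lemma tendsto_one_sub_cpow_neg_div {p : ℕ} (hp : p ≠ 0) :
    Tendsto (fun s : ℂ => (1 - (p : ℂ) ^ (-s)) / s) (𝓝[≠] 0) (𝓝 ((Real.log p : ℝ) : ℂ)) := by
  have h : HasDerivAt (fun s : ℂ => 1 - (p : ℂ) ^ (-s)) (Complex.log p) 0 := by
    simpa using ((hasDerivAt_neg (0 : ℂ)).const_cpow (c := (p : ℂ))
      (Or.inl (Nat.cast_ne_zero.mpr hp))).const_sub 1
  rw [hasDerivAt_iff_tendsto_slope] at h
  simpa [slope_fun_def, div_eq_inv_mul] using h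

/-- For `m ≥ 2` and `χ₀` the principal character mod `m`, as `s → 0`, `s ≠ 0`,
`L(s,χ₀)/s^{ω(m)}` tends to `-(1/2)·∏_{p ∣ m} log p ≠ 0`; so `L(·,χ₀)` vanishes to order
exactly `ω(m)` at `0`. -/
theorem stmt5 (m : ℕ) [NeZero m] (hm : 2 ≤ m) :
    Tendsto (fun s : ℂ =>
        DirichletCharacter.LFunction (1 : DirichletCharacter ℂ m) s / s ^ m.primeFactors.card)
      (𝓝[≠] 0)
      (𝓝 (-(1 / 2 : ℂ) * ∏ p ∈ m.primeFactors, ((Real.log p : ℝ) : ℂ))) ∧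
    (-(1 / 2 : ℂ) * ∏ p ∈ m.primeFactors, ((Real.log p : ℝ) : ℂ)) ≠ 0 := by
  constructor
  · have hζ : Tendsto riemannZeta (𝓝[≠] 0) (𝓝 (-(1 / 2 : ℂ))) := by
      have := (differentiableAt_riemannZeta (zero_ne_one (α := ℂ))).continuousAt.tendsto
      rw [riemannZeta_zero, neg_div] at this
      exact this.mono_left nhdsWithin_le_nhds
    have hprod := tendsto_finsetProd m.primeFactors fun p hp =>
      tendsto_one_sub_cpow_neg_div (Nat.prime_of_mem_primeFactors hp).ne_zero
    refine (hζ.mul hprod).congr' ?_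
    have hne : ∀ᶠ s : ℂ in 𝓝[≠] 0, s ≠ 1 :=
      nhdsWithin_le_nhds (isOpen_ne.mem_nhds zero_ne_one)
    filter_upwards [hne] with s hs
    have hL := DirichletCharacter.LFunctionTrivChar_eq_mul_riemannZeta (N := m) hs
    rw [DirichletCharacter.LFunctionTrivChar] at hL
    rw [hL, Finset.prod_div_distrib, Finset.prod_const]
    ring
  · refine mul_ne_zero (by norm_num) (Finset.prod_ne_zero_iff.mpr fun p hp => ?_)
    have hp := (Nat.prime_of_mem_primeFactors hp).one_lt
    exact_mod_cast (Real.log_pos (by exact_mod_cast hp)).ne'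
end

section
/- Let m ≥ 2 and let χ₀ be the principal Dirichlet character modulo m. If m has exactly one prime divisor p (i.e. ω(m) = 1), then the derivative of s ↦ L(s, χ₀) at s = 0 equals -(1/2) · log p. If ω(m) ≥ 2, then the derivative of s ↦ L(s, χ₀) at s = 0 equals 0. -/
/-- The Euler factor `1 - n ^ (-s)` has derivative `log n` at `s = 0`. -/
theorem hasDerivAt_one_sub_cpow_neg_zero {n : ℕ} (hn : n ≠ 0) :
    HasDerivAt (fun s : ℂ => 1 - (n : ℂ) ^ (-s)) (Real.log n : ℂ) 0 := by
  have h := ((hasDerivAt_neg (0 : ℂ)).const_cpow (c := (n : ℂ))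
    (Or.inl (Nat.cast_ne_zero.mpr hn))).const_sub 1
  simpa [Complex.natCast_log] using h

/-- The derivative at `0` of the `L`-function of the principal character modulo `m ≥ 2`. -/
theorem hasDerivAt_LFunctionTrivChar_zero (m : ℕ) [NeZero m] (hm : 2 ≤ m) :
    HasDerivAt (DirichletCharacter.LFunctionTrivChar m)
      (-(1 / 2 : ℂ) * ∑ p ∈ m.primeFactors,
        (0 : ℂ) ^ (m.primeFactors.erase p).card * (Real.log p : ℂ)) 0 := by
  have hprod : HasDerivAt (fun s : ℂ => ∏ p ∈ m.primeFactors, (1 - (p : ℂ) ^ (-s)))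
      (∑ p ∈ m.primeFactors, (0 : ℂ) ^ (m.primeFactors.erase p).card * (Real.log p : ℂ)) 0 := by
    have h := HasDerivAt.fun_finsetProd (u := m.primeFactors) (x := (0 : ℂ))
      (f := fun (p : ℕ) (s : ℂ) => 1 - (p : ℂ) ^ (-s)) (f' := fun p => (Real.log p : ℂ))
      fun p hp => hasDerivAt_one_sub_cpow_neg_zero (Nat.prime_of_mem_primeFactors hp).ne_zero
    simpa only [neg_zero, Complex.cpow_zero, sub_self, Finset.prod_const, smul_eq_mul] using h
  have hzero : ∏ p ∈ m.primeFactors, (1 - (p : ℂ) ^ (-(0 : ℂ))) = 0 := by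
    obtain ⟨p, hp⟩ := Nat.nonempty_primeFactors.mpr hm
    exact Finset.prod_eq_zero hp (by simp)
  have hmul := hprod.mul (differentiableAt_riemannZeta zero_ne_one).hasDerivAt
  rw [hzero, zero_mul, add_zero, riemannZeta_zero] at hmul
  have heq : DirichletCharacter.LFunctionTrivChar m =ᶠ[nhds 0]
      (fun s : ℂ => ∏ p ∈ m.primeFactors, (1 - (p : ℂ) ^ (-s))) * riemannZeta := by
    filter_upwards [isOpen_ne.mem_nhds (zero_ne_one (α := ℂ))] with s hs
    exact DirichletCharacter.LFunctionTrivChar_eq_mul_riemannZeta hs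
  exact (hmul.congr_of_eventuallyEq heq).congr_deriv (by ring)

/-- For `m ≥ 2` and `χ₀` the principal character mod `m`: if `m` has exactly
one prime divisor `p`, then `L'(0,χ₀) = -(1/2)·log p`; if `ω(m) ≥ 2`, then `L'(0,χ₀) = 0`. -/
theorem stmt6 (m : ℕ) [NeZero m] (hm : 2 ≤ m) :
    (∀ p : ℕ, p.Prime → m.primeFactors = {p} →
      deriv (fun s : ℂ => DirichletCharacter.LFunction (1 : DirichletCharacter ℂ m) s) 0 =
        -(1 / 2 : ℂ) * ((Real.log p : ℝ) : ℂ)) ∧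
    (2 ≤ m.primeFactors.card →
      deriv (fun s : ℂ => DirichletCharacter.LFunction (1 : DirichletCharacter ℂ m) s) 0 = 0) := by
  have hderiv := (hasDerivAt_LFunctionTrivChar_zero m hm).deriv
  refine ⟨fun p _ hp => hderiv.trans ?_, fun hcard => hderiv.trans ?_⟩
  · simp [hp]
  · rw [Finset.sum_eq_zero, mul_zero]
    intro p hp
    rw [Finset.card_erase_of_mem hp, zero_pow (by omega), zero_mul]
end

section
/- Let m ≥ 2, let χ₀ be the principal Dirichlet character modulo m, and let ℓ = ω(m) be the number of distinct prime divisors of m. Then L^{(ℓ+1)}(0, χ₀) / ( (ℓ+1) · L^{(ℓ)}(0, χ₀) ) = log(2π) - (1/2) · ∑_{p | m, p prime} log p, where L^{(j)}(0, χ₀) denotes the j-th iterated derivative of s ↦ L(s, χ₀) at s = 0 (note L^{(ℓ)}(0, χ₀) ≠ 0 by the order-of-vanishing result, and ζ'(0)/ζ(0) = log(2π)). -/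
open Real

section

open Complex Filter Topology

lemma iteratedDeriv_pow_mul_self {f : ℂ → ℂ} (hf : AnalyticAt ℂ f 0) (n : ℕ) :
    iteratedDeriv n (fun s ↦ s ^ n * f s) 0 = n.factorial * f 0 := by
  rw [iteratedDeriv_fun_mul (by fun_prop) hf.contDiffAt,
    Finset.sum_eq_single_of_mem n (by simp)]
  · simp [-iteratedDeriv_pow, iteratedDeriv_fun_pow_zero]
  · intro i _ hi
    simp [-iteratedDeriv_pow, iteratedDeriv_fun_pow_zero, hi]

lemma iteratedDeriv_succ_pow_mul {f : ℂ → ℂ} (hf : AnalyticAt ℂ f 0) (n : ℕ) :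
    iteratedDeriv (n + 1) (fun s ↦ s ^ n * f s) 0 = (n + 1).factorial * deriv f 0 := by
  rw [iteratedDeriv_fun_mul (by fun_prop) hf.contDiffAt,
    Finset.sum_eq_single_of_mem n (by simp)]
  · simp [-iteratedDeriv_pow, iteratedDeriv_fun_pow_zero, Nat.factorial_succ]
  · intro i _ hi
    simp [-iteratedDeriv_pow, iteratedDeriv_fun_pow_zero, hi]

/-- The entire function `s ↦ (1 - exp (-c * s)) / s`, with its removable singularity filled in. -/
noncomputable def oneSubExpDiv (c : ℂ) : ℂ → ℂ := dslope (fun s ↦ 1 - cexp (-c * s)) 0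

lemma mul_oneSubExpDiv (c s : ℂ) : s * oneSubExpDiv c s = 1 - cexp (-c * s) := by
  simpa [oneSubExpDiv] using sub_smul_dslope (fun s ↦ 1 - cexp (-c * s)) 0 s

lemma differentiable_oneSubExpDiv (c : ℂ) : Differentiable ℂ (oneSubExpDiv c) := by
  rw [← differentiableOn_univ]
  exact (Complex.differentiableOn_dslope univ_mem).2 (by fun_prop)

lemma oneSubExpDiv_zero (c : ℂ) : oneSubExpDiv c 0 = c := by
  have h := iteratedDeriv_pow_mul_self ((differentiable_oneSubExpDiv c).analyticAt 0) 1
  simp only [pow_one, mul_oneSubExpDiv] at h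
  rw [iteratedDeriv_const_sub one_pos, iteratedDeriv_neg, iteratedDeriv_cexp_const_mul] at h
  simpa using h.symm

lemma deriv_oneSubExpDiv_zero (c : ℂ) : deriv (oneSubExpDiv c) 0 = -c ^ 2 / 2 := by
  have h := iteratedDeriv_succ_pow_mul ((differentiable_oneSubExpDiv c).analyticAt 0) 1
  simp only [pow_one, mul_oneSubExpDiv] at h
  rw [iteratedDeriv_const_sub (by simp), iteratedDeriv_neg, iteratedDeriv_cexp_const_mul] at h
  simp at h
  linear_combination -h / 2

lemma logDeriv_oneSubExpDiv_zero (c : ℂ) : logDeriv (oneSubExpDiv c) 0 = -c / 2 := by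
  rw [logDeriv_apply, deriv_oneSubExpDiv_zero, oneSubExpDiv_zero]
  rcases eq_or_ne c 0 with rfl | hc
  · simp
  · field_simp

lemma LFunctionTrivChar_eq_pow_mul (m : ℕ) [NeZero m] {s : ℂ} (hs : s ≠ 1) :
    DirichletCharacter.LFunctionTrivChar m s =
      s ^ m.primeFactors.card *
        (riemannZeta s * ∏ p ∈ m.primeFactors, oneSubExpDiv (Real.log p) s) := by
  rw [DirichletCharacter.LFunctionTrivChar_eq_mul_riemannZeta hs, mul_left_comm,
    ← Finset.prod_const, ← Finset.prod_mul_distrib, mul_comm]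
  congr 1
  refine Finset.prod_congr rfl fun p hp ↦ ?_
  have hp0 : (p : ℂ) ≠ 0 := mod_cast (Nat.prime_of_mem_primeFactors hp).ne_zero
  rw [mul_oneSubExpDiv, cpow_def_of_ne_zero hp0, Complex.natCast_log, mul_neg, neg_mul]

lemma logDeriv_riemannZeta_zero : logDeriv riemannZeta 0 = (Real.log (2 * π) : ℝ) := by
  rw [logDeriv_apply, deriv_riemannZeta_zero, riemannZeta_zero, ofReal_log (by positivity)]
  push_cast
  ring

end

/-- For `m ≥ 2`, `χ₀` the principal character mod `m`, `ℓ = ω(m)`: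
`L^{(ℓ+1)}(0,χ₀)/((ℓ+1)·L^{(ℓ)}(0,χ₀)) = log(2π) - (1/2)·∑_{p ∣ m} log p`. -/
theorem stmt7 (m : ℕ) [NeZero m] (hm : 2 ≤ m) :
    iteratedDeriv (m.primeFactors.card + 1)
        (fun s : ℂ => DirichletCharacter.LFunction (1 : DirichletCharacter ℂ m) s) 0 /
      (((m.primeFactors.card : ℕ) + 1 : ℂ) *
        iteratedDeriv m.primeFactors.card
          (fun s : ℂ => DirichletCharacter.LFunction (1 : DirichletCharacter ℂ m) s) 0) =
      ((Real.log (2 * Real.pi) : ℝ) : ℂ) -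
        (1 / 2 : ℂ) * ∑ p ∈ m.primeFactors, ((Real.log p : ℝ) : ℂ) := by
  set n := m.primeFactors.card
  set G : ℂ → ℂ := fun s ↦ riemannZeta s * ∏ p ∈ m.primeFactors, oneSubExpDiv (Real.log p) s
    with hG
  have hlog : ∀ p ∈ m.primeFactors, ((Real.log p : ℝ) : ℂ) ≠ 0 := fun p hp ↦
    mod_cast (Real.log_pos (mod_cast (Nat.prime_of_mem_primeFactors hp).one_lt)).ne'
  have hζ0 : riemannZeta 0 ≠ 0 := by norm_num [riemannZeta_zero]
  have hP0 : ∏ p ∈ m.primeFactors, oneSubExpDiv (Real.log p) 0 ≠ 0 :=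
    Finset.prod_ne_zero_iff.2 fun p hp ↦ by simpa only [oneSubExpDiv_zero] using hlog p hp
  have hP : Differentiable ℂ fun s ↦ ∏ p ∈ m.primeFactors, oneSubExpDiv (Real.log p) s :=
    Differentiable.fun_finsetProd fun p _ ↦ differentiable_oneSubExpDiv _
  have hGan : AnalyticAt ℂ G 0 := by
    refine AnalyticAt.mul ?_ (hP.analyticAt 0)
    exact differentiableOn_riemannZeta.analyticAt (isOpen_compl_singleton.mem_nhds (by simp))
  have heq : (fun s : ℂ ↦ DirichletCharacter.LFunction (1 : DirichletCharacter ℂ m) s)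
      =ᶠ[nhds 0] fun s ↦ s ^ n * G s :=
    (eventually_ne_nhds zero_ne_one).mono fun s hs ↦ LFunctionTrivChar_eq_pow_mul m hs
  have hGlog : logDeriv G 0 = ((Real.log (2 * Real.pi) : ℝ) : ℂ) -
      (1 / 2 : ℂ) * ∑ p ∈ m.primeFactors, ((Real.log p : ℝ) : ℂ) := by
    rw [hG, logDeriv_mul _ hζ0 hP0 (differentiableAt_riemannZeta zero_ne_one) (hP 0),
      logDeriv_riemannZeta_zero, logDeriv_prod (Finset.prod_ne_zero_iff.1 hP0)
        fun p _ ↦ differentiable_oneSubExpDiv _ 0]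
    simp only [logDeriv_oneSubExpDiv_zero, ← Finset.sum_div, Finset.sum_neg_distrib]
    ring
  have hG0 : G 0 ≠ 0 := mul_ne_zero hζ0 hP0
  have hfac : (n.factorial : ℂ) ≠ 0 := mod_cast n.factorial_ne_zero
  have hn : (n + 1 : ℂ) ≠ 0 := mod_cast n.succ_ne_zero
  rw [heq.iteratedDeriv_eq, heq.iteratedDeriv_eq, iteratedDeriv_pow_mul_self hGan,
    iteratedDeriv_succ_pow_mul hGan, ← hGlog, logDeriv_apply, Nat.factorial_succ]
  push_cast
  field_simp
end

section
/- Let N ≥ 2 and let r be an integer with 1 ≤ r ≤ N, and set d = gcd(N, r). Assume d is squarefree. For every complex t with Re(t) > 1, ∑_{ℓ=0}^{∞} μ(Nℓ + r) / (Nℓ + r)^{t} = ( μ(d) / ( d^{t} · φ(N/d) ) ) · ∑_{η mod N/d} η(r/d)^{-1} / ( L(t, η) · ∏_{p | d, p prime} (1 - η(p) p^{-t}) ), where the sum on the right is over all Dirichlet characters modulo N/d, μ is the Möbius function, φ is Euler's totient function, and L(t, η) is the Dirichlet L-function of η. -/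
/-- Raising the level of `χ` from `M` to `M * d` kills exactly the integers not coprime to `d`. -/
theorem DirichletCharacter.changeLevel_mul_natCast {R : Type*} [CommRing R] {M : ℕ}
    (d : ℕ) (χ : DirichletCharacter R M) (n : ℕ) :
    changeLevel (Dvd.intro d rfl) χ (n : ZMod (M * d)) =
      if n.Coprime d then χ (n : ZMod M) else 0 := by
  by_cases h : n.Coprime (M * d)
  · rw [if_pos (Nat.Coprime.coprime_mul_left_right h)]
    simpa using changeLevel_eq_cast_of_dvd' χ (Dvd.intro d rfl)
      (Nat.isCoprime_iff_coprime.mpr h)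
  · rw [MulChar.map_nonunit _ (by rwa [ZMod.isUnit_iff_coprime])]
    split_ifs with hd
    · rw [MulChar.map_nonunit]
      rw [ZMod.isUnit_iff_coprime]
      exact fun hM ↦ h (hM.mul_right hd)
    · rfl

/-- The `L`-series of `μ` twisted by `χ` and restricted to integers coprime to `d`. -/
theorem DirichletCharacter.LSeries_changeLevel_mul_moebius {M d : ℕ} [NeZero M] (hd : d ≠ 0)
    (χ : DirichletCharacter ℂ M) {s : ℂ} (hs : 1 < s.re) :
    LSeries ((fun n : ℕ ↦ changeLevel (Dvd.intro d rfl) χ (n : ZMod (M * d))) *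
        fun n : ℕ ↦ ((ArithmeticFunction.moebius n : ℤ) : ℂ)) s =
      (LFunction χ s * ∏ p ∈ d.primeFactors, (1 - χ (p : ZMod M) * (p : ℂ) ^ (-s)))⁻¹ := by
  have : NeZero (M * d) := ⟨mul_ne_zero (NeZero.ne M) hd⟩
  have hprod : ∏ p ∈ d.primeFactors, (1 - χ (p : ZMod M) * (p : ℂ) ^ (-s)) =
      ∏ p ∈ (M * d).primeFactors, (1 - χ (p : ZMod M) * (p : ℂ) ^ (-s)) := by
    refine Finset.prod_subset (Nat.primeFactors_mono (Dvd.intro_left M rfl) (NeZero.ne _)) ?_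
    intro p hp hpd
    have hpp := Nat.prime_of_mem_primeFactors hp
    have hpM : p ∣ M := by
      rcases hpp.dvd_mul.mp (Nat.dvd_of_mem_primeFactors hp) with h | h
      · exact h
      · exact absurd (Nat.mem_primeFactors.mpr ⟨hpp, h, hd⟩) hpd
    rw [MulChar.map_nonunit _ (by rwa [ZMod.isUnit_prime_iff_not_dvd hpp, not_not])]
    simp
  rw [LFunction_eq_LSeries χ hs, hprod, ← LSeries_changeLevel (Dvd.intro d rfl) χ hs]
  exact eq_inv_of_mul_eq_one_right (LSeries.mul_mu_eq_one _ hs)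

theorem DirichletCharacter.sum_inv_mul_changeLevel {M : ℕ} [NeZero M] (d : ℕ) {a : ℕ}
    (ha : a.Coprime M) (n : ℕ) :
    ∑ χ : DirichletCharacter ℂ M, (χ (a : ZMod M))⁻¹ *
        changeLevel (Dvd.intro d rfl) χ (n : ZMod (M * d)) =
      if n.Coprime d ∧ (a : ZMod M) = n then (M.totient : ℂ) else 0 := by
  have hu : IsUnit (a : ZMod M) := (ZMod.isUnit_iff_coprime a M).mpr ha
  have hinv (χ : DirichletCharacter ℂ M) : (χ (a : ZMod M))⁻¹ = χ (a : ZMod M)⁻¹ := by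
    refine inv_eq_of_mul_eq_one_left ?_
    rw [← map_mul, ZMod.inv_mul_of_unit _ hu, map_one]
  simp only [changeLevel_mul_natCast, hinv]
  by_cases h : n.Coprime d
  · simp only [if_pos h, sum_char_inv_mul_char_eq ℂ hu, and_iff_right h]
  · simp [h]

/-- A sum over the progression `M * ℓ + a`, `1 ≤ a ≤ M`, as a sum over a residue class. -/
theorem tsum_mul_add_eq_tsum_ite {M a : ℕ} (ha : 1 ≤ a) (haM : a ≤ M) {f : ℕ → ℂ}
    (hf : f 0 = 0) :
    ∑' ℓ : ℕ, f (M * ℓ + a) = ∑' n : ℕ, if (a : ZMod M) = n then f n else 0 := by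
  have hinj : Function.Injective fun ℓ : ℕ ↦ M * ℓ + a := fun x y h ↦
    Nat.eq_of_mul_eq_mul_left (by lia) (Nat.add_right_cancel h)
  rw [← hinj.tsum_eq (f := fun n : ℕ ↦ if (a : ZMod M) = n then f n else 0)]
  · simp
  · intro n hn
    obtain ⟨hmod, hfn⟩ : (a : ZMod M) = n ∧ f n ≠ 0 := by simpa using hn
    have hn0 : 0 < n := Nat.pos_of_ne_zero fun h ↦ hfn (h ▸ hf)
    have han : a ≤ n := by
      by_contra! hlt
      have h := (Nat.modEq_iff_dvd' hlt.le).mp ((ZMod.natCast_eq_natCast_iff _ _ _).mp hmod).symm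
      have := Nat.le_of_dvd (by lia) h
      lia
    obtain ⟨k, hk⟩ := (Nat.modEq_iff_dvd' han).mp ((ZMod.natCast_eq_natCast_iff _ _ _).mp hmod)
    exact ⟨k, by simp only; lia⟩

theorem ArithmeticFunction.moebius_mul_eq_ite (d m : ℕ) :
    moebius (d * m) = if m.Coprime d then moebius d * moebius m else 0 := by
  split_ifs with h
  · exact isMultiplicative_moebius.map_mul_of_coprime h.symm
  · exact moebius_eq_zero_of_not_squarefree fun hsq ↦
      h (Nat.coprime_of_squarefree_mul hsq).symm


/-- For `N ≥ 2`, `1 ≤ r ≤ N`, `d = gcd(N,r)` squarefree, and `Re(t) > 1`: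
`∑_{ℓ≥0} μ(Nℓ+r)/(Nℓ+r)^t
  = (μ(d)/(d^t φ(N/d))) ∑_{η mod N/d} η(r/d)⁻¹ / (L(t,η) ∏_{p ∣ d} (1 - η(p) p^{-t}))`. -/
theorem stmt9 (N r d : ℕ) (hN : 2 ≤ N) (hr1 : 1 ≤ r) (hrN : r ≤ N)
    (hd : d = Nat.gcd N r) [NeZero (N / d)] (hsqf : Squarefree d) (t : ℂ) (ht : 1 < t.re) :
    (∑' ℓ : ℕ, ((ArithmeticFunction.moebius (N * ℓ + r) : ℤ) : ℂ) /
        (((N * ℓ + r : ℕ) : ℂ) ^ t)) =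
      ((ArithmeticFunction.moebius d : ℤ) : ℂ) / (((d : ℕ) : ℂ) ^ t * ((N / d).totient : ℂ)) *
        ∑ η : DirichletCharacter ℂ (N / d),
          (η (((r / d : ℕ) : ZMod (N / d))))⁻¹ /
            (DirichletCharacter.LFunction η t *
              ∏ p ∈ d.primeFactors, (1 - η ((p : ZMod (N / d))) * ((p : ℕ) : ℂ) ^ (-t))) := by
  have hd0 : d ≠ 0 := hsqf.ne_zero
  obtain ⟨M, hNM⟩ : d ∣ N := hd ▸ Nat.gcd_dvd_left N r
  obtain ⟨a, hra⟩ : d ∣ r := hd ▸ Nat.gcd_dvd_right N r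
  have hdpos : 0 < d := Nat.pos_of_ne_zero hd0
  have hMdiv : N / d = M := by rw [hNM, Nat.mul_div_cancel_left _ hdpos]
  have hadiv : r / d = a := by rw [hra, Nat.mul_div_cancel_left _ hdpos]
  have hcop : a.Coprime M := by
    rw [← hMdiv, ← hadiv, hd]
    exact (Nat.coprime_div_gcd_div_gcd (hd ▸ hdpos)).symm
  have ha1 : 1 ≤ a := Nat.pos_of_ne_zero fun h ↦ by simp [h] at hra; lia
  have haM : a ≤ M := Nat.le_of_mul_le_mul_left (hra ▸ hNM ▸ hrN) hdpos
  clear hd hsqf hN hr1 hrN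
  subst hMdiv
  rw [hadiv]
  generalize N / d = M at *
  subst hNM hra
  set f : ℕ → ℂ := fun n ↦
    if n.Coprime d then LSeries.term (fun n ↦ ((ArithmeticFunction.moebius n : ℤ) : ℂ)) t n else 0
    with hf
  have hφ : (M.totient : ℂ) ≠ 0 :=
    Nat.cast_ne_zero.mpr (Nat.totient_pos.mpr (NeZero.pos M)).ne'
  have hleft (ℓ : ℕ) : ((ArithmeticFunction.moebius (d * M * ℓ + d * a) : ℤ) : ℂ) /
      ((d * M * ℓ + d * a : ℕ) : ℂ) ^ t =
      ((ArithmeticFunction.moebius d : ℤ) : ℂ) / (d : ℂ) ^ t * f (M * ℓ + a) := by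
    have hne : M * ℓ + a ≠ 0 := by lia
    rw [mul_assoc, ← mul_add, ArithmeticFunction.moebius_mul_eq_ite, Nat.cast_mul,
      Complex.natCast_mul_natCast_cpow]
    simp only [hf]
    split_ifs
    · rw [LSeries.term_of_ne_zero hne, Int.cast_mul, mul_div_mul_comm]
    · simp
  have hright : ∑ η : DirichletCharacter ℂ M, (η (a : ZMod M))⁻¹ /
        (DirichletCharacter.LFunction η t *
          ∏ p ∈ d.primeFactors, (1 - η (p : ZMod M) * (p : ℂ) ^ (-t))) =
      (M.totient : ℂ) * ∑' n : ℕ, if (a : ZMod M) = n then f n else 0 := by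
    simp only [div_eq_mul_inv, ← DirichletCharacter.LSeries_changeLevel_mul_moebius hd0 _ ht,
      LSeries, ← tsum_mul_left]
    rw [← Summable.tsum_finsetSum fun η _ ↦ (DirichletCharacter.LSeriesSummable_mul _
      (ArithmeticFunction.LSeriesSummable_moebius_iff.mpr ht)).mul_left _]
    refine tsum_congr fun n ↦ ?_
    rcases eq_or_ne n 0 with rfl | hn
    · simp [hf]
    simp only [LSeries.term_of_ne_zero hn, Pi.mul_apply, mul_div_assoc, ← mul_assoc]
    rw [← Finset.sum_mul, DirichletCharacter.sum_inv_mul_changeLevel d hcop n]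
    by_cases h1 : n.Coprime d <;> by_cases h2 : (a : ZMod M) = n <;>
      simp [hf, h1, h2, LSeries.term_of_ne_zero hn]
  rw [tsum_congr hleft, tsum_mul_left, tsum_mul_add_eq_tsum_ite ha1 haM (by simp [hf]), hright]
  field_simp
end

section
/- As t → 0 in ℂ with t ≠ 0, the function t ↦ 1 / ( (1 - 2^{-t}) · ζ(t) ) + 2 / (t · log 2) tends to the limit -1 + 2·log(2π)/log 2, where ζ is the Riemann zeta function. (Equivalently, the constant term in the Laurent expansion at t = 0 of 1/((1 - 2^{-t}) ζ(t)) equals -1 - 4ζ'(0)/log 2.) -/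
open Filter Topology

/-- The function `(exp z - 1) / z`, continued by `1` at the origin, has derivative `1 / 2` there. -/
lemma hasDerivAt_dslope_cexp_zero : HasDerivAt (dslope Complex.exp 0) (1 / 2) 0 := by
  have hO : (fun z : ℂ => Complex.exp z - ∑ i ∈ Finset.range 3, z ^ i / (i.factorial : ℂ))
      =o[𝓝 0] fun z : ℂ => z ^ 2 :=
    (Complex.exp_sub_sum_range_isBigO_pow 3).trans_isLittleO
      (Asymptotics.isLittleO_pow_pow (by norm_num))
  have hlim := (hO.tendsto_div_nhds_zero.mono_left
    (nhdsWithin_le_nhds (s := {0}ᶜ))).add_const (1 / 2 : ℂ)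
  rw [zero_add] at hlim
  rw [hasDerivAt_iff_tendsto_slope]
  refine hlim.congr' ?_
  filter_upwards [self_mem_nhdsWithin] with z hz
  have hz : z ≠ 0 := hz
  simp only [slope_def_field, dslope_of_ne _ hz, dslope_same, Complex.deriv_exp,
    Finset.sum_range_succ, Finset.sum_range_zero, Complex.exp_zero, Nat.factorial]
  push_cast
  field_simp
  ring

/-- As `t → 0`, `t ≠ 0`, the function
`t ↦ 1/((1 - 2^{-t}) ζ(t)) + 2/(t log 2)` tends to `-1 + 2 log(2π)/log 2`. -/
theorem stmt10 :
    Tendsto (fun t : ℂ =>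
        1 / ((1 - (2 : ℂ) ^ (-t)) * riemannZeta t) + 2 / (t * ((Real.log 2 : ℝ) : ℂ)))
      (𝓝[≠] 0)
      (𝓝 ((-1 : ℂ) + 2 * ((Real.log (2 * Real.pi) : ℝ) : ℂ) / ((Real.log 2 : ℝ) : ℂ))) := by
  set L : ℂ := ((Real.log 2 : ℝ) : ℂ) with hL
  set M : ℂ := ((Real.log (2 * Real.pi) : ℝ) : ℂ) with hM
  have hL0 : L ≠ 0 := by
    rw [hL, Complex.ofReal_ne_zero]
    exact (Real.log_pos one_lt_two).ne'
  have hL2 : Complex.log 2 = L := by rw [hL, Complex.ofReal_log zero_le_two, Complex.ofReal_ofNat]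
  have hE0 : dslope Complex.exp 0 0 = 1 := by simp
  have hE : HasDerivAt (fun t : ℂ => dslope Complex.exp 0 (-t * L)) (-L / 2) 0 := by
    have hlin : HasDerivAt (fun t : ℂ => -t * L) (-1 * L) 0 :=
      (hasDerivAt_id (0 : ℂ)).neg.mul_const L
    have hexp : HasDerivAt (dslope Complex.exp 0) (1 / 2) (-(0 : ℂ) * L) := by
      simpa using hasDerivAt_dslope_cexp_zero
    exact (hexp.comp (0 : ℂ) hlin).congr_deriv (by ring)
  have hζ : HasDerivAt riemannZeta (-M / 2) 0 := by
    have h := (differentiableAt_riemannZeta (zero_ne_one' ℂ)).hasDerivAt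
    rw [deriv_riemannZeta_zero] at h
    refine h.congr_deriv ?_
    rw [hM, Complex.ofReal_log (by positivity)]
    push_cast
    rfl
  have hF := ((hE.mul hζ).const_mul L).inv (by simp [riemannZeta_zero, hL0])
  rw [hasDerivAt_iff_tendsto_slope] at hF
  have hval : -(L * (-L / 2 * riemannZeta 0 + dslope Complex.exp 0 (-0 * L) * (-M / 2))) /
      (L * (dslope Complex.exp 0 (-0 * L) * riemannZeta 0)) ^ 2 = -1 + 2 * M / L := by
    rw [neg_zero, zero_mul, hE0, riemannZeta_zero]
    field_simp
    ring
  rw [← hval]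
  refine hF.congr' ?_
  have hζ0 : ∀ᶠ t in 𝓝[≠] (0 : ℂ), riemannZeta t ≠ 0 :=
    (hζ.continuousAt.eventually_ne (by simp [riemannZeta_zero])).filter_mono nhdsWithin_le_nhds
  filter_upwards [self_mem_nhdsWithin, hζ0] with t ht hζt
  have ht : t ≠ 0 := ht
  have htL : -t * L ≠ 0 := mul_ne_zero (neg_ne_zero.mpr ht) hL0
  have hpow : (2 : ℂ) ^ (-t) = Complex.exp (-t * L) := by
    rw [Complex.cpow_def_of_ne_zero two_ne_zero, hL2, mul_comm]
  have hu : L * dslope Complex.exp 0 (-t * L) = (1 - (2 : ℂ) ^ (-t)) / t := by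
    rw [dslope_of_ne _ htL, slope_def_field, hpow, Complex.exp_zero]
    field_simp
    ring
  simp only [slope_def_field, Pi.mul_apply, Pi.inv_apply, ← mul_assoc, hu, neg_zero, zero_mul,
    hE0, riemannZeta_zero]
  simp only [div_eq_mul_inv, mul_inv, inv_inv, inv_neg, one_mul, mul_one, sub_zero]
  field_simp
  ring
end

section
/- As t → 0 in ℂ with t ≠ 0, the function t ↦ -2^{-t} / ( (1 - 2^{-t}) · ζ(t) ) - 2 / (t · log 2) tends to the limit -1 - 2·log(2π)/log 2, where ζ is the Riemann zeta function. (Equivalently, the constant term in the Laurent expansion at t = 0 of -2^{-t}/((1 - 2^{-t}) ζ(t)) equals -1 + 4ζ'(0)/log 2.) -/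
open Filter Topology

theorem Complex.tendsto_exp_sub_one_sub_id_div_sq :
    Tendsto (fun z : ℂ => (Complex.exp z - 1 - z) / z ^ 2) (𝓝[≠] 0) (𝓝 (1 / 2)) := by
  have h : (fun z : ℂ => Complex.exp z - 1 - z - z ^ 2 / 2) =o[𝓝[≠] 0] fun z => z ^ 2 := by
    refine Asymptotics.IsLittleO.mono ?_ nhdsWithin_le_nhds
    refine (Complex.exp_sub_sum_range_succ_isLittleO_pow 2).congr_left fun z => ?_
    simp [Finset.sum_range_succ, Nat.factorial]
    ring
  have h' := h.tendsto_div_nhds_zero.add_const (1 / 2 : ℂ)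
  rw [zero_add] at h'
  refine h'.congr' ?_
  filter_upwards [self_mem_nhdsWithin] with z (hz : z ≠ 0)
  field_simp
  ring

/-- As `t → 0`, `t ≠ 0`, the function
`t ↦ -2^{-t}/((1 - 2^{-t}) ζ(t)) - 2/(t log 2)` tends to `-1 - 2 log(2π)/log 2`. -/
theorem stmt11 :
    Tendsto (fun t : ℂ =>
        -(2 : ℂ) ^ (-t) / ((1 - (2 : ℂ) ^ (-t)) * riemannZeta t) -
          2 / (t * ((Real.log 2 : ℝ) : ℂ)))
      (𝓝[≠] 0)
      (𝓝 ((-1 : ℂ) - 2 * ((Real.log (2 * Real.pi) : ℝ) : ℂ) / ((Real.log 2 : ℝ) : ℂ))) := by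
  have hpow (t : ℂ) : (2 : ℂ) ^ (-t) = (Complex.exp (((Real.log 2 : ℝ) : ℂ) * t))⁻¹ := by
    rw [Complex.cpow_def_of_ne_zero two_ne_zero, ← Complex.exp_neg]
    congr 1
    rw [Complex.ofReal_log (by norm_num)]
    push_cast
    ring
  have hL : ((Real.log 2 : ℝ) : ℂ) ≠ 0 :=
    Complex.ofReal_ne_zero.2 (Real.log_pos one_lt_two).ne'
  have hζ' : HasDerivAt riemannZeta (-((Real.log (2 * Real.pi) : ℝ) : ℂ) / 2) 0 := by
    have h := (differentiableAt_riemannZeta zero_ne_one).hasDerivAt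
    rw [deriv_riemannZeta_zero] at h
    rw [Complex.ofReal_log (by positivity)]
    push_cast
    exact h
  simp_rw [hpow]
  generalize ((Real.log 2 : ℝ) : ℂ) = L at hL ⊢
  generalize ((Real.log (2 * Real.pi) : ℝ) : ℂ) = P at hζ' ⊢
  have hζ : Tendsto riemannZeta (𝓝[≠] 0) (𝓝 (-1 / 2)) := by
    simpa [riemannZeta_zero] using hζ'.continuousAt.tendsto.mono_left nhdsWithin_le_nhds
  have hζ_slope : Tendsto (fun t => (riemannZeta t + 1 / 2) / t) (𝓝[≠] 0) (𝓝 (-P / 2)) := by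
    refine (hasDerivAt_iff_tendsto_slope.1 hζ').congr fun t => ?_
    rw [slope_def_field, riemannZeta_zero]
    ring
  have hmul : Tendsto (fun t : ℂ => L * t) (𝓝[≠] 0) (𝓝[≠] 0) := by
    refine tendsto_nhdsWithin_iff.2 ⟨?_, ?_⟩
    · exact ((continuous_const_mul L).tendsto' 0 0 (mul_zero L)).mono_left nhdsWithin_le_nhds
    · filter_upwards [self_mem_nhdsWithin] with t ht using mul_ne_zero hL ht
  have hexp_slope : Tendsto (fun t => (Complex.exp (L * t) - 1) / t) (𝓝[≠] 0) (𝓝 L) := by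
    have h : HasDerivAt (fun t => Complex.exp (L * t)) L 0 := by
      simpa using ((hasDerivAt_id (0 : ℂ)).const_mul L).cexp
    refine (hasDerivAt_iff_tendsto_slope.1 h).congr fun t => ?_
    simp [slope_def_field]
  have hexp_second := Complex.tendsto_exp_sub_one_sub_id_div_sq.comp hmul
  have hlim := (((hexp_second.mul_const (L ^ 2)).sub
    ((hexp_slope.mul hζ_slope).const_mul 2))).div ((hexp_slope.mul hζ).mul_const L)
    (by simp [hL])
  have hval : (1 / 2 * L ^ 2 - 2 * (L * (-P / 2))) / (L * (-1 / 2) * L) = -1 - 2 * P / L := by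
    field_simp
    ring
  rw [hval] at hlim
  refine hlim.congr' ?_
  filter_upwards [self_mem_nhdsWithin, hζ.eventually_ne (by norm_num : (-1 / 2 : ℂ) ≠ 0),
    hexp_slope.eventually_ne hL] with t (ht : t ≠ 0) hζt hexp
  have hE : Complex.exp (L * t) - 1 ≠ 0 := fun h => hexp (by rw [h, zero_div])
  have hfirst : -(Complex.exp (L * t))⁻¹ / ((1 - (Complex.exp (L * t))⁻¹) * riemannZeta t) =
      -1 / ((Complex.exp (L * t) - 1) * riemannZeta t) := by
    have h0 := Complex.exp_ne_zero (L * t)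
    have h1 : 1 - (Complex.exp (L * t))⁻¹ = (Complex.exp (L * t) - 1) / Complex.exp (L * t) := by
      field_simp
    rw [h1]
    field_simp
  rw [hfirst]
  simp only [Function.comp_apply, Pi.div_apply]
  generalize Complex.exp (L * t) = E at hE ⊢
  field_simp
  ring
end

section
/- Let m ≥ 1 and let a be an integer with gcd(a, m) = 1. For every complex s with Re(s) > 1 and every complex t, (1/φ(m)) · ∑_{n=1}^{∞} ∑_{χ mod m} (μ(n)/n^{t}) · χ(a)^{-1} · L'(ns, χ^{n}) / L(ns, χ^{n}) = - ∑_{n=1}^{∞} (μ(n)/n^{t}) · ∑_{k ≥ 1, k^{n} ≡ a (mod m)} Λ(k) · k^{-ns}, where the inner character sum is over all Dirichlet characters modulo m, L(·, χ^n) is the Dirichlet L-function of χ^n and L' its derivative, μ is the Möbius function, Λ is the von Mangoldt function, and φ is Euler's totient function; all series converge absolutely. -/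
open ArithmeticFunction in
lemma summable_vonMangoldt_mul_cpow {w : ℂ} (hw : 1 < w.re) :
    Summable fun k : ℕ ↦ ((vonMangoldt k : ℝ) : ℂ) * (k : ℂ) ^ (-w) := by
  refine (LSeriesSummable_vonMangoldt hw).congr fun k ↦ ?_
  rw [LSeries.term_def₀ (by simp)]

open ArithmeticFunction in
lemma norm_vonMangoldt_mul_cpow_le {s : ℂ} (hs : 1 < s.re) (n k : ℕ) :
    ‖((vonMangoldt k : ℝ) : ℂ) * (k : ℂ) ^ (-(((n + 1 : ℕ) : ℂ) * s))‖ ≤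
      (1 / 2) ^ n * ‖((vonMangoldt k : ℝ) : ℂ) * (k : ℂ) ^ (-s)‖ := by
  rcases lt_or_ge k 2 with hk | hk
  · interval_cases k <;> simp
  have hk0 : 0 < k := by lia
  have hkC : (k : ℂ) ≠ 0 := by exact_mod_cast hk0.ne'
  have hsplit : (k : ℂ) ^ (-(((n + 1 : ℕ) : ℂ) * s)) = ((k : ℂ) ^ (-s)) ^ n * (k : ℂ) ^ (-s) := by
    rw [← pow_succ, ← Complex.cpow_nat_mul]
    ring_nf
  have hle : ‖(k : ℂ) ^ (-s)‖ ≤ 1 / 2 := by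
    rw [Complex.norm_natCast_cpow_of_pos hk0, Complex.neg_re]
    calc (k : ℝ) ^ (-s.re) ≤ (k : ℝ) ^ (-1 : ℝ) :=
          Real.rpow_le_rpow_of_exponent_le (by exact_mod_cast hk0) (by linarith)
      _ = 1 / (k : ℝ) := by rw [Real.rpow_neg_one, one_div]
      _ ≤ 1 / 2 := one_div_le_one_div_of_le (by norm_num) (by exact_mod_cast hk)
  rw [hsplit, norm_mul, norm_mul, norm_mul, norm_pow, mul_left_comm]
  gcongr

lemma summable_natCast_succ_cpow_mul_half_pow (t : ℂ) :
    Summable fun n : ℕ ↦ ‖(((n + 1 : ℕ) : ℂ) ^ t)⁻¹‖ * (1 / 2 : ℝ) ^ n := by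
  obtain ⟨j, hj⟩ := exists_nat_ge (-t.re)
  have h : Summable fun n : ℕ ↦ (n : ℝ) ^ j * (1 / 2 : ℝ) ^ n :=
    summable_pow_mul_geometric_of_norm_lt_one j (by norm_num)
  refine (((summable_nat_add_iff 1).mpr h).mul_left 2).of_nonneg_of_le
    (fun n ↦ by positivity) fun n ↦ ?_
  have hle : ‖(((n + 1 : ℕ) : ℂ) ^ t)⁻¹‖ ≤ ((n + 1 : ℕ) : ℝ) ^ j := by
    rw [← Complex.cpow_neg, Complex.norm_natCast_cpow_of_pos n.succ_pos, ← Real.rpow_natCast,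
      Complex.neg_re]
    exact Real.rpow_le_rpow_of_exponent_le (by exact_mod_cast n.succ_pos) hj
  calc _ ≤ ((n + 1 : ℕ) : ℝ) ^ j * (1 / 2 : ℝ) ^ n := by gcongr
    _ = _ := by rw [pow_succ (1 / 2 : ℝ)]; ring

open ArithmeticFunction in
lemma summable_moebius_div_cpow_mul_tsum_vonMangoldt {s : ℂ} (hs : 1 < s.re) (t : ℂ)
    (S : ℕ → Set ℕ) :
    Summable fun n : ℕ+ ↦ ((moebius n : ℤ) : ℂ) / (((n : ℕ) : ℂ) ^ t) *
      ∑' k : S n, ((vonMangoldt k : ℝ) : ℂ) * ((k : ℕ) : ℂ) ^ (-(((n : ℕ) : ℂ) * s)) := by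
  rw [← Equiv.pnatEquivNat.symm.summable_iff]
  set C := ∑' k : ℕ, ‖((vonMangoldt k : ℝ) : ℂ) * (k : ℂ) ^ (-s)‖
  have hsum := (summable_vonMangoldt_mul_cpow hs).norm
  refine .of_norm_bounded ((summable_natCast_succ_cpow_mul_half_pow t).mul_right C) fun n ↦ ?_
  have hn : ((Equiv.pnatEquivNat.symm n : ℕ+) : ℕ) = n + 1 := rfl
  simp only [Function.comp_apply, hn]
  have hmoebius : ‖((moebius (n + 1) : ℤ) : ℂ)‖ ≤ 1 := by
    rw [Complex.norm_intCast]
    exact_mod_cast abs_moebius_le_one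
  have hinner : ‖∑' k : S (n + 1), ((vonMangoldt k : ℝ) : ℂ) *
      ((k : ℕ) : ℂ) ^ (-(((n + 1 : ℕ) : ℂ) * s))‖ ≤ (1 / 2) ^ n * C := by
    have hsub : Summable fun k : S (n + 1) ↦
        (1 / 2 : ℝ) ^ n * ‖((vonMangoldt k : ℝ) : ℂ) * ((k : ℕ) : ℂ) ^ (-s)‖ :=
      (hsum.subtype (S (n + 1))).mul_left _
    refine (tsum_of_norm_bounded hsub.hasSum fun k ↦ norm_vonMangoldt_mul_cpow_le hs n k).trans ?_
    rw [tsum_mul_left]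
    gcongr
    exact hsum.tsum_subtype_le _ _ fun k ↦ norm_nonneg _
  rw [norm_mul, div_eq_mul_inv, norm_mul, mul_assoc (‖(((n + 1 : ℕ) : ℂ) ^ t)⁻¹‖)]
  calc _ ≤ 1 * ‖(((n + 1 : ℕ) : ℂ) ^ t)⁻¹‖ * ((1 / 2) ^ n * C) := by gcongr; exact hinner
    _ = _ := by rw [one_mul]

open ArithmeticFunction in
lemma DirichletCharacter.hasSum_neg_deriv_LFunction_div {m : ℕ} [NeZero m]
    (χ : DirichletCharacter ℂ m) {w : ℂ} (hw : 1 < w.re) :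
    HasSum (fun k : ℕ ↦ χ k * (((vonMangoldt k : ℝ) : ℂ) * (k : ℂ) ^ (-w)))
      (-(deriv (LFunction χ) w / LFunction χ w)) := by
  have h := (LSeriesSummable_twist_vonMangoldt χ hw).LSeriesHasSum
  rw [LSeries_twist_vonMangoldt_eq χ hw, ← deriv_LFunction_eq_deriv_LSeries χ hw,
    ← LFunction_eq_LSeries χ hw, neg_div] at h
  refine HasSum.congr_fun h fun k ↦ ?_
  rw [LSeries.term_def₀ (by simp)]
  simp [mul_assoc]

open ArithmeticFunction in
lemma DirichletCharacter.sum_inv_mul_deriv_LFunction_pow_div {m : ℕ} [NeZero m] {a : ZMod m}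
    (ha : IsUnit a) {n : ℕ} (hn : n ≠ 0) {w : ℂ} (hw : 1 < w.re) :
    ∑ χ : DirichletCharacter ℂ m,
        (χ a)⁻¹ * (deriv (LFunction (χ ^ n)) w / LFunction (χ ^ n) w) =
      -(m.totient * ∑' k : {k : ℕ // 1 ≤ k ∧ (k : ZMod m) ^ n = a},
        ((vonMangoldt k : ℝ) : ℂ) * ((k : ℕ) : ℂ) ^ (-w)) := by
  have hinv (χ : DirichletCharacter ℂ m) : (χ a)⁻¹ = χ a⁻¹ := by
    refine (eq_inv_of_mul_eq_one_right ?_).symm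
    rw [← map_mul, ZMod.mul_inv_of_unit a ha, map_one]
  have h : HasSum (fun k : ℕ ↦ ∑ χ : DirichletCharacter ℂ m, (χ a)⁻¹ *
      ((χ ^ n) k * (((vonMangoldt k : ℝ) : ℂ) * (k : ℂ) ^ (-w))))
      (∑ χ : DirichletCharacter ℂ m,
        (χ a)⁻¹ * (-(deriv (LFunction (χ ^ n)) w / LFunction (χ ^ n) w))) :=
    hasSum_sum fun χ _ ↦ ((χ ^ n).hasSum_neg_deriv_LFunction_div hw).mul_left _
  have hterm (k : ℕ) : ∑ χ : DirichletCharacter ℂ m, (χ a)⁻¹ *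
      ((χ ^ n) k * (((vonMangoldt k : ℝ) : ℂ) * (k : ℂ) ^ (-w))) =
      m.totient * {k : ℕ | 1 ≤ k ∧ (k : ZMod m) ^ n = a}.indicator
        (fun k ↦ ((vonMangoldt k : ℝ) : ℂ) * (k : ℂ) ^ (-w)) k := by
    simp_rw [hinv, ← mul_assoc, MulChar.pow_apply' _ hn, ← map_pow, ← Finset.sum_mul]
    rw [sum_char_inv_mul_char_eq ℂ ha]
    rcases k.eq_zero_or_pos with rfl | hk
    · simp
    · by_cases hka : (k : ZMod m) ^ n = a
      · simp [Set.indicator, hka, Nat.one_le_iff_ne_zero, hk.ne', mul_assoc]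
      · simp [Set.indicator, hka, Ne.symm hka]
  simp_rw [mul_neg, Finset.sum_neg_distrib, hterm] at h
  rw [← neg_eq_iff_eq_neg, ← h.tsum_eq, tsum_mul_left]
  congr 1
  exact (tsum_subtype {k : ℕ | 1 ≤ k ∧ (k : ZMod m) ^ n = a}
    fun k ↦ ((vonMangoldt k : ℝ) : ℂ) * (k : ℂ) ^ (-w)).symm

/-- For `m ≥ 1`, `gcd(a,m) = 1`, `Re(s) > 1` and `t : ℂ`:
`(1/φ(m)) ∑_{n≥1} ∑_{χ mod m} (μ(n)/n^t) χ(a)⁻¹ L'(ns,χ^n)/L(ns,χ^n)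
  = -∑_{n≥1} (μ(n)/n^t) ∑_{k≥1, k^n ≡ a (m)} Λ(k) k^{-ns}`;
all series converge (absolutely, as these are series of complex numbers). -/
theorem stmt16 (m : ℕ) [NeZero m] (hm : 1 ≤ m) (a : ℤ) (ha : Int.gcd a m = 1)
    (s : ℂ) (hs : 1 < s.re) (t : ℂ) :
    (∀ n : ℕ+, Summable (fun k : {k : ℕ // 1 ≤ k ∧ ((k : ZMod m)) ^ (n : ℕ) = ((a : ZMod m))} =>
      ((ArithmeticFunction.vonMangoldt k : ℝ) : ℂ) *
        ((k : ℕ) : ℂ) ^ (-(((n : ℕ) : ℂ) * s)))) ∧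
    Summable (fun n : ℕ+ =>
      ∑ χ : DirichletCharacter ℂ m,
        ((ArithmeticFunction.moebius n : ℤ) : ℂ) / (((n : ℕ) : ℂ) ^ t) *
          (χ ((a : ZMod m)))⁻¹ *
          (deriv (fun z : ℂ => DirichletCharacter.LFunction (χ ^ (n : ℕ)) z) (((n : ℕ) : ℂ) * s) /
            DirichletCharacter.LFunction (χ ^ (n : ℕ)) (((n : ℕ) : ℂ) * s))) ∧
    Summable (fun n : ℕ+ =>
      ((ArithmeticFunction.moebius n : ℤ) : ℂ) / (((n : ℕ) : ℂ) ^ t) *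
        ∑' k : {k : ℕ // 1 ≤ k ∧ ((k : ZMod m)) ^ (n : ℕ) = ((a : ZMod m))},
          ((ArithmeticFunction.vonMangoldt k : ℝ) : ℂ) *
            ((k : ℕ) : ℂ) ^ (-(((n : ℕ) : ℂ) * s))) ∧
    (1 / (m.totient : ℂ)) * (∑' n : ℕ+,
        ∑ χ : DirichletCharacter ℂ m,
          ((ArithmeticFunction.moebius n : ℤ) : ℂ) / (((n : ℕ) : ℂ) ^ t) *
            (χ ((a : ZMod m)))⁻¹ *
            (deriv (fun z : ℂ => DirichletCharacter.LFunction (χ ^ (n : ℕ)) z)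
                (((n : ℕ) : ℂ) * s) /
              DirichletCharacter.LFunction (χ ^ (n : ℕ)) (((n : ℕ) : ℂ) * s))) =
      -∑' n : ℕ+,
        ((ArithmeticFunction.moebius n : ℤ) : ℂ) / (((n : ℕ) : ℂ) ^ t) *
          ∑' k : {k : ℕ // 1 ≤ k ∧ ((k : ZMod m)) ^ (n : ℕ) = ((a : ZMod m))},
            ((ArithmeticFunction.vonMangoldt k : ℝ) : ℂ) *
              ((k : ℕ) : ℂ) ^ (-(((n : ℕ) : ℂ) * s)) := by
  have hunit : IsUnit (a : ZMod m) :=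
    (ZMod.coe_int_isUnit_iff_isCoprime a m).mpr (Int.isCoprime_iff_gcd_eq_one.mpr ha).symm
  have hre (n : ℕ+) : 1 < (((n : ℕ) : ℂ) * s).re := by
    have hn : (1 : ℝ) ≤ (n : ℕ) := by exact_mod_cast n.pos
    rw [← Complex.ofReal_natCast, Complex.re_ofReal_mul]
    nlinarith
  have hsum := summable_moebius_div_cpow_mul_tsum_vonMangoldt hs t
    fun n ↦ {k : ℕ | 1 ≤ k ∧ (k : ZMod m) ^ n = (a : ZMod m)}
  have hterm (n : ℕ+) := DirichletCharacter.sum_inv_mul_deriv_LFunction_pow_div hunit n.ne_zero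
    (hre n)
  have hφ : (m.totient : ℂ) ≠ 0 := by exact_mod_cast (Nat.totient_pos.mpr hm).ne'
  simp_rw [mul_assoc, ← Finset.mul_sum]
  simp_rw [hterm, mul_neg, mul_left_comm _ (m.totient : ℂ)]
  refine ⟨fun n ↦ (summable_vonMangoldt_mul_cpow (hre n)).subtype _, (hsum.mul_left _).neg, hsum, ?_⟩
  rw [tsum_neg, tsum_mul_left, mul_neg, one_div, inv_mul_cancel_left₀ hφ]
end

section
/- For every real x ≥ 2, the real number log( ∑_{n=1}^{∞} n^{-x} ) satisfies 0 ≤ log( ∑_{n=1}^{∞} n^{-x} ) ≤ 2^{2-x}; here the series is the Riemann zeta value ζ(x), which converges since x > 1. -/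
/-- The Basel series, indexed by the positive integers. -/
theorem hasSum_pnat_rpow_neg_two :
    HasSum (fun n : ℕ+ => ((n : ℕ) : ℝ) ^ (-2 : ℝ)) (Real.pi ^ 2 / 6) := by
  have h := (PNat.coe_injective.hasSum_iff (f := fun n : ℕ => (1 : ℝ) / (n : ℝ) ^ 2)
    (a := Real.pi ^ 2 / 6) (fun n hn => ?_)).2 hasSum_zeta_two
  · refine h.congr_fun fun n => ?_
    simp
  · have hn0 : n = 0 := by
      by_contra h0
      exact hn ⟨⟨n, Nat.pos_of_ne_zero h0⟩, rfl⟩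
    simp [hn0]

theorem pnat_rpow_neg_le {x : ℝ} (hx : 2 ≤ x) (n : ℕ+) :
    ((n : ℕ) : ℝ) ^ (-x) ≤ (2 : ℝ) ^ (2 - x) * ((n : ℕ) : ℝ) ^ (-2 : ℝ) +
      if n = 1 then 1 - (2 : ℝ) ^ (2 - x) else 0 := by
  split_ifs with h
  · simp [h]
  · have hn : 2 ≤ (n : ℕ) := by
      have h1 : (n : ℕ) ≠ 1 := fun h' => h (PNat.coe_eq_one_iff.1 h')
      have := n.pos
      omega
    have hn' : (2 : ℝ) ≤ ((n : ℕ) : ℝ) := by exact_mod_cast hn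
    have hpos : (0 : ℝ) < ((n : ℕ) : ℝ) := by linarith
    calc ((n : ℕ) : ℝ) ^ (-x) = ((n : ℕ) : ℝ) ^ (2 - x) * ((n : ℕ) : ℝ) ^ (-2 : ℝ) := by
          rw [← Real.rpow_add hpos]
          ring_nf
      _ ≤ (2 : ℝ) ^ (2 - x) * ((n : ℕ) : ℝ) ^ (-2 : ℝ) := by
          gcongr ?_ * _
          exact Real.rpow_le_rpow_of_nonpos two_pos hn' (by linarith)
      _ = _ := (add_zero _).symm

/-- For every real `x ≥ 2`,
`0 ≤ log(∑_{n≥1} n^{-x}) ≤ 2^{2-x}` (the series is `ζ(x)`, convergent since `x > 1`). -/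
theorem stmt17 (x : ℝ) (hx : 2 ≤ x) :
    0 ≤ Real.log (∑' n : ℕ+, ((n : ℕ) : ℝ) ^ (-x)) ∧
    Real.log (∑' n : ℕ+, ((n : ℕ) : ℝ) ^ (-x)) ≤ (2 : ℝ) ^ (2 - x) := by
  have hbound := (hasSum_pnat_rpow_neg_two.mul_left ((2 : ℝ) ^ (2 - x))).add
    (hasSum_ite_eq (1 : ℕ+) (1 - (2 : ℝ) ^ (2 - x)))
  have hnonneg (n : ℕ+) : 0 ≤ ((n : ℕ) : ℝ) ^ (-x) := by positivity
  have hsum : Summable fun n : ℕ+ => ((n : ℕ) : ℝ) ^ (-x) :=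
    .of_nonneg_of_le hnonneg (pnat_rpow_neg_le hx) hbound.summable
  have hle := hasSum_le (pnat_rpow_neg_le hx) hsum.hasSum hbound
  have hge : 1 ≤ ∑' n : ℕ+, ((n : ℕ) : ℝ) ^ (-x) := by
    simpa using hsum.le_tsum 1 fun n _ => hnonneg n
  refine ⟨Real.log_nonneg hge, (Real.log_le_sub_one_of_pos (by linarith)).trans ?_⟩
  have hc : (0 : ℝ) < 2 ^ (2 - x) := by positivity
  have hpi : Real.pi ^ 2 / 6 ≤ 2 := by
    nlinarith [Real.pi_lt_d2, Real.pi_pos]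
  nlinarith [mul_le_mul_of_nonneg_left hpi hc.le]
end
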